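/- arXiv:2112.08085 — 3 statements merged into one kernel-verified Lean document; each statement's English description precedes it below -/
import Mathlib

section
/- Let n be a positive integer with n ≡ 0 (mod 3), let d be a divisor of n/3, and set g = n/(3d). Then: (i) M_{n,3}^1(d) ∪ M_{n,3}^2(d) = ⋃_{h ∈ D_{g,3}} G_n(hd); (ii) M_{n,3}^0(d) = M_n(3d) ∪ {0}. -/
/-- `Mn n d = {dk : 1 ≤ dk ≤ n-1}`. -/
def Mn (n d : ℕ) : Finset ℕ := (Finset.Ico 1 n).filter (fun x => d ∣ x)

/-- `Gn n d = {dk : 1 ≤ dk ≤ n-1, gcd(dk, n) = d}`. -/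
def Gn (n d : ℕ) : Finset ℕ := (Finset.Ico 1 n).filter (fun x => Nat.gcd x n = d)

/-- `M3 n d r = M_{n,3}^r(d) = {dk : 0 ≤ dk ≤ n-1, k ≡ r (mod 3)}`. -/
def M3 (n d r : ℕ) : Finset ℕ :=
  (Finset.range n).filter (fun x => d ∣ x ∧ x / d % 3 = r)

/-- `D3 g = D_{g,3} = {k : k ∣ g, k ≢ 0 (mod 3)}`. -/
def D3 (g : ℕ) : Finset ℕ := g.divisors.filter (fun k => k % 3 ≠ 0)

theorem stmt1 (n d : ℕ) (hn : 0 < n) (h3 : n % 3 = 0) (hd : d ∣ n / 3) :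
    (M3 n d 1 ∪ M3 n d 2 = (D3 (n / (3 * d))).biUnion (fun h => Gn n (h * d))) ∧
    (M3 n d 0 = Mn n (3 * d) ∪ {0}) := by
  obtain ⟨m, rfl⟩ : 3 ∣ n := Nat.dvd_of_mod_eq_zero h3
  rw [Nat.mul_div_cancel_left m (by norm_num)] at hd
  obtain ⟨g, rfl⟩ := hd
  have hd0 : 0 < d := by
    rcases Nat.eq_zero_or_pos d with rfl | h
    · simp at hn
    · exact h
  have hg0 : 0 < g := by
    rcases Nat.eq_zero_or_pos g with rfl | h
    · simp at hn
    · exact h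
  have hdiv : 3 * (d * g) / (3 * d) = g := by
    rw [← mul_assoc, Nat.mul_div_cancel_left g (by positivity)]
  have hgcd (k : ℕ) : Nat.gcd (d * k) (3 * (d * g)) = Nat.gcd k (3 * g) * d := by
    rw [mul_left_comm, Nat.gcd_mul_left, mul_comm]
  rw [hdiv]
  constructor
  · ext x
    simp only [M3, D3, Gn, Finset.mem_union, Finset.mem_filter, Finset.mem_range,
      Finset.mem_biUnion, Nat.mem_divisors, Finset.mem_Ico]
    constructor
    · intro h
      obtain ⟨hx, ⟨k, rfl⟩, hk⟩ :
          x < 3 * (d * g) ∧ d ∣ x ∧ x / d % 3 ≠ 0 := by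
        rcases h with ⟨h1, h2, h3⟩ | ⟨h1, h2, h3⟩ <;> exact ⟨h1, h2, by omega⟩
      rw [Nat.mul_div_cancel_left k hd0] at hk
      have h3k : ¬ 3 ∣ Nat.gcd k (3 * g) := fun h =>
        hk (Nat.mod_eq_zero_of_dvd (h.trans (Nat.gcd_dvd_left _ _)))
      have hk0 : 0 < k := by omega
      refine ⟨Nat.gcd k (3 * g), ⟨⟨?_, hg0.ne'⟩, fun h => h3k (Nat.dvd_of_mod_eq_zero h)⟩,
        ⟨Nat.mul_pos hd0 hk0, hx⟩, hgcd k⟩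
      exact ((Nat.prime_three.coprime_iff_not_dvd.mpr h3k).symm).dvd_of_dvd_mul_left
        (Nat.gcd_dvd_right _ _)
    · rintro ⟨h, ⟨-, hh⟩, ⟨-, hx⟩, hxg⟩
      obtain ⟨k, rfl⟩ : d ∣ x :=
        (hxg ▸ Dvd.intro_left h rfl : d ∣ Nat.gcd x (3 * (d * g))).trans (Nat.gcd_dvd_left _ _)
      rw [hgcd] at hxg
      have hkh : Nat.gcd k (3 * g) = h := Nat.eq_of_mul_eq_mul_right hd0 hxg
      have hk : k % 3 ≠ 0 := fun h0 => hh (Nat.mod_eq_zero_of_dvd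
        (hkh ▸ Nat.dvd_gcd (Nat.dvd_of_mod_eq_zero h0) (Dvd.intro g rfl)))
      rw [Nat.mul_div_cancel_left k hd0]
      have : k % 3 = 1 ∨ k % 3 = 2 := by omega
      exact this.imp (fun h => ⟨hx, Dvd.intro k rfl, h⟩) (fun h => ⟨hx, Dvd.intro k rfl, h⟩)
  · ext x
    simp only [M3, Mn, Finset.mem_union, Finset.mem_filter, Finset.mem_range, Finset.mem_Ico,
      Finset.mem_singleton]
    have key : (d ∣ x ∧ x / d % 3 = 0) ↔ 3 * d ∣ x := by
      constructor
      · rintro ⟨⟨k, rfl⟩, hk⟩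
        rw [Nat.mul_div_cancel_left k hd0] at hk
        rw [mul_comm 3 d]
        exact Nat.mul_dvd_mul_left d (Nat.dvd_of_mod_eq_zero hk)
      · rintro ⟨k, rfl⟩
        refine ⟨⟨3 * k, by ring⟩, ?_⟩
        rw [mul_comm 3 d, mul_assoc, Nat.mul_div_cancel_left _ hd0, Nat.mul_mod_right]
    rw [key]
    rcases Nat.eq_zero_or_pos x with rfl | hx
    · simpa using hn
    · simp [hx.ne', Nat.one_le_iff_ne_zero]
end

section
/- Let n be a positive integer with n ≡ 0 (mod 3), let d be a divisor of n/3, and set g = n/(3d). Then: (i) G_{n,3}^1(d) ∩ G_{n,3}^2(d) = ∅; (ii) G_n(d) = G_{n,3}^1(d) ∪ G_{n,3}^2(d); (iii) M_{n,3}^1(d) = (⋃_{h ∈ D_{g,3}^1} G_{n,3}^1(hd)) ∪ (⋃_{h ∈ D_{g,3}^2} G_{n,3}^2(hd)); (iv) M_{n,3}^2(d) = (⋃_{h ∈ D_{g,3}^1} G_{n,3}^2(hd)) ∪ (⋃_{h ∈ D_{g,3}^2} G_{n,3}^1(hd)). -/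
/-- `G3 n d r = G_{n,3}^r(d) = {dk : 1 ≤ dk ≤ n-1, gcd(dk, n) = d, k ≡ r (mod 3)}`. -/
def G3 (n d r : ℕ) : Finset ℕ :=
  (Finset.Ico 1 n).filter (fun x => Nat.gcd x n = d ∧ x / d % 3 = r)

/-- `D3r g r = D_{g,3}^r = {k : k ∣ g, k ≡ r (mod 3)}`. -/
def D3r (g r : ℕ) : Finset ℕ := g.divisors.filter (fun k => k % 3 = r)

theorem mem_G3 {n d r x : ℕ} :
    x ∈ G3 n d r ↔ (1 ≤ x ∧ x < n) ∧ Nat.gcd x n = d ∧ x / d % 3 = r := by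
  simp [G3]

theorem mem_M3 {n d r x : ℕ} : x ∈ M3 n d r ↔ x < n ∧ d ∣ x ∧ x / d % 3 = r := by
  simp [M3]

theorem mem_D3r {g r h : ℕ} : h ∈ D3r g r ↔ (h ∣ g ∧ g ≠ 0) ∧ h % 3 = r := by
  simp [D3r]

theorem not_three_dvd_div_gcd {n d x : ℕ} (hn : 3 * d ∣ n) (hd : 0 < d)
    (h : Nat.gcd x n = d) : x / d % 3 ≠ 0 := by
  intro h0
  have hdx : d ∣ x := h ▸ Nat.gcd_dvd_left x n
  obtain ⟨k, rfl⟩ := hdx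
  rw [Nat.mul_div_cancel_left k hd] at h0
  have h3 : d * 3 ∣ Nat.gcd (d * k) n :=
    Nat.dvd_gcd (Nat.mul_dvd_mul_left d (Nat.dvd_of_mod_eq_zero h0)) (mul_comm 3 d ▸ hn)
  rw [h] at h3
  have := Nat.le_of_dvd hd h3
  omega

theorem mem_M3_iff_exists_mem_G3 {d g r x : ℕ} (hd : 0 < d) (hg : 0 < g) (hr : r ≠ 0) :
    x ∈ M3 (3 * d * g) d r ↔
      ∃ h s, h ∣ g ∧ x ∈ G3 (3 * d * g) (h * d) s ∧ h * s % 3 = r := by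
  constructor
  · intro hx
    obtain ⟨hlt, ⟨k, rfl⟩, hk⟩ := mem_M3.1 hx
    rw [Nat.mul_div_cancel_left k hd] at hk
    have hk0 : 0 < k := by
      rcases Nat.eq_zero_or_pos k with rfl | hk0
      · omega
      · exact hk0
    have hcop : Nat.Coprime 3 k :=
      (Nat.Prime.coprime_iff_not_dvd Nat.prime_three).2 (by omega)
    have hgcd : Nat.gcd (d * k) (3 * d * g) = Nat.gcd k g * d := by
      rw [show 3 * d * g = d * (3 * g) by ring, Nat.gcd_mul_left,
        hcop.gcd_mul_left_cancel_right, mul_comm]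
    have hpos : 0 < Nat.gcd k g := Nat.gcd_pos_of_pos_left g hk0
    refine ⟨Nat.gcd k g, k / Nat.gcd k g % 3, Nat.gcd_dvd_right k g,
      mem_G3.2 ⟨⟨Nat.mul_pos hd hk0, hlt⟩, hgcd, ?_⟩, ?_⟩
    · rw [mul_comm d k, Nat.mul_div_mul_right _ _ hd]
    · rw [Nat.mul_mod, Nat.mod_mod, ← Nat.mul_mod, Nat.mul_div_cancel' (Nat.gcd_dvd_left k g), hk]
  · rintro ⟨h, s, hhg, hx, hs⟩
    obtain ⟨⟨-, hlt⟩, hgcd, hj⟩ := mem_G3.1 hx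
    have hh : 0 < h := Nat.pos_of_dvd_of_pos hhg hg
    have hdvd : h * d ∣ x := hgcd ▸ Nat.gcd_dvd_left x _
    obtain ⟨j, rfl⟩ := hdvd
    rw [Nat.mul_div_cancel_left j (Nat.mul_pos hh hd)] at hj
    refine mem_M3.2 ⟨hlt, ⟨h * j, by ring⟩, ?_⟩
    rw [show h * d * j = d * (h * j) by ring, Nat.mul_div_cancel_left _ hd, ← hs, ← hj,
      Nat.mul_mod h (j % 3), Nat.mod_mod, ← Nat.mul_mod]

theorem M3_eq_biUnion_union {d g r s t : ℕ} (hd : 0 < d) (hg : 0 < g)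
    (h : r = 1 ∧ s = 1 ∧ t = 2 ∨ r = 2 ∧ s = 2 ∧ t = 1) :
    M3 (3 * d * g) d r = (D3r g 1).biUnion (fun h => G3 (3 * d * g) (h * d) s) ∪
      (D3r g 2).biUnion (fun h => G3 (3 * d * g) (h * d) t) := by
  ext x
  rw [mem_M3_iff_exists_mem_G3 hd hg (by omega)]
  simp only [Finset.mem_union, Finset.mem_biUnion, mem_D3r]
  constructor
  · rintro ⟨k, u, hkg, hx, hu⟩
    have hu3 : u < 3 := (mem_G3.1 hx).2.2 ▸ Nat.mod_lt _ (by norm_num)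
    have hk3 : k % 3 < 3 := Nat.mod_lt _ (by norm_num)
    rw [Nat.mul_mod] at hu
    have hcases : k % 3 = 1 ∧ u = s ∨ k % 3 = 2 ∧ u = t := by
      interval_cases k % 3 <;> interval_cases u <;> omega
    rcases hcases with ⟨hk, rfl⟩ | ⟨hk, rfl⟩
    · exact Or.inl ⟨k, ⟨⟨hkg, hg.ne'⟩, hk⟩, hx⟩
    · exact Or.inr ⟨k, ⟨⟨hkg, hg.ne'⟩, hk⟩, hx⟩
  · rintro (⟨k, ⟨⟨hkg, -⟩, hk⟩, hx⟩ | ⟨k, ⟨⟨hkg, -⟩, hk⟩, hx⟩)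
    · refine ⟨k, s, hkg, hx, ?_⟩
      rcases h with ⟨rfl, rfl, rfl⟩ | ⟨rfl, rfl, rfl⟩ <;> omega
    · refine ⟨k, t, hkg, hx, ?_⟩
      rcases h with ⟨rfl, rfl, rfl⟩ | ⟨rfl, rfl, rfl⟩ <;> omega

theorem stmt2 (n d : ℕ) (hn : 0 < n) (h3 : n % 3 = 0) (hd : d ∣ n / 3) :
    (G3 n d 1 ∩ G3 n d 2 = ∅) ∧
    (Gn n d = G3 n d 1 ∪ G3 n d 2) ∧
    (M3 n d 1 = (D3r (n / (3 * d)) 1).biUnion (fun h => G3 n (h * d) 1) ∪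
        (D3r (n / (3 * d)) 2).biUnion (fun h => G3 n (h * d) 2)) ∧
    (M3 n d 2 = (D3r (n / (3 * d)) 1).biUnion (fun h => G3 n (h * d) 2) ∪
        (D3r (n / (3 * d)) 2).biUnion (fun h => G3 n (h * d) 1)) := by
  obtain ⟨g, hg⟩ := hd
  obtain rfl : n = 3 * d * g := by rw [mul_assoc]; omega
  have hd0 : 0 < d := Nat.pos_of_ne_zero (by rintro rfl; simp at hn)
  have hg0 : 0 < g := Nat.pos_of_ne_zero (by rintro rfl; simp at hn)
  rw [Nat.mul_div_cancel_left g (by positivity : 0 < 3 * d)]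
  refine ⟨?_, ?_, M3_eq_biUnion_union hd0 hg0 (by simp), M3_eq_biUnion_union hd0 hg0 (by simp)⟩
  · ext x
    simp only [Finset.mem_inter, mem_G3, Finset.notMem_empty, iff_false]
    omega
  · ext x
    simp only [Finset.mem_union, mem_G3, Gn, Finset.mem_filter, Finset.mem_Ico]
    constructor
    · rintro ⟨hx, hgcd⟩
      have := not_three_dvd_div_gcd (Dvd.intro g rfl) hd0 hgcd
      rcases (by omega : x / d % 3 = 1 ∨ x / d % 3 = 2) with h | h
      · exact Or.inl ⟨hx, hgcd, h⟩
      · exact Or.inr ⟨hx, hgcd, h⟩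
    · rintro (⟨hx, hgcd, -⟩ | ⟨hx, hgcd, -⟩) <;> exact ⟨hx, hgcd⟩
end

section
/- Let n be a positive integer with n ≡ 0 (mod 3) and let v be a vector of complex numbers indexed by ℤ_n such that every coordinate v_s lies in ℚ(ω_3) (i.e., v_s = a_s + b_s ω_3 with a_s, b_s ∈ ℚ) and Σ_{t ∈ ℤ_n} ω_n^{st} v_t is a rational number for every s ∈ ℤ_n. Then: (i) the complex conjugate of v_s equals v_{-s} for every s ∈ ℤ_n; (ii) if d divides n/3 and s, t ∈ {1,...,n-1} both lie in G_{n,3}^1(d), then v_s = v_t (coordinates taken at the corresponding residues); (iii) if d divides n, d does not divide n/3, d < n, and r ∈ {1,...,n-1} lies in G_n(d), then v_r = v_{n-r}. -/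
/-- `om m` is the primitive `m`-th root of unity `exp(2πi/m)`. -/
noncomputable def om (m : ℕ) : ℂ := Complex.exp (2 * Real.pi * Complex.I / m)

open ZMod in
lemma stdAddChar_eq_om_pow {n : ℕ} [NeZero n] (j : ZMod n) : stdAddChar j = om n ^ j.val := by
  rw [stdAddChar_apply, toCircle_apply, om, ← Complex.exp_nat_mul]
  congr 1
  ring

lemma isPrimitiveRoot_om (n : ℕ) [NeZero n] : IsPrimitiveRoot (om n) n :=
  Complex.isPrimitiveRoot_exp n (NeZero.ne n)

lemma om_pow_div {n m : ℕ} [NeZero n] (h : m ∣ n) : om n ^ (n / m) = om m := by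
  obtain ⟨k, rfl⟩ := h
  have hmk : m * k ≠ 0 := NeZero.ne _
  have hm : m ≠ 0 := left_ne_zero_of_mul hmk
  have hk : k ≠ 0 := right_ne_zero_of_mul hmk
  rw [Nat.mul_div_cancel_left _ (Nat.pos_of_ne_zero hm), om, om, ← Complex.exp_nat_mul]
  congr 1
  push_cast
  field_simp

/-- The Galois action on the `n`-th cyclotomic field, phrased through polynomial relations. -/
lemma aeval_om_pow_eq_zero {n u : ℕ} [NeZero n] (hu : u.Coprime n) {P : Polynomial ℚ}
    (hP : Polynomial.aeval (om n) P = 0) : Polynomial.aeval (om n ^ u) P = 0 := by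
  have hn : 0 < n := NeZero.pos n
  have h1 := isPrimitiveRoot_om n
  have h2 := h1.pow_of_coprime u hu
  have e : minpoly ℚ (om n ^ u) = minpoly ℚ (om n) := by
    rw [← Polynomial.cyclotomic_eq_minpoly_rat h1 hn, ← Polynomial.cyclotomic_eq_minpoly_rat h2 hn]
  have hd : minpoly ℚ (om n ^ u) ∣ P := e ▸ minpoly.dvd ℚ _ hP
  exact Polynomial.aeval_eq_zero_of_dvd_aeval_eq_zero hd (minpoly.aeval ℚ _)

open ZMod in
/-- Fourier inversion for a vector whose discrete Fourier transform is rational. -/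
lemma exists_rat_stdAddChar_expansion {n : ℕ} [NeZero n] {v : ZMod n → ℂ}
    (hEv : ∀ s : ZMod n, ∃ q : ℚ, ∑ t : ZMod n, om n ^ (s.val * t.val) * v t = (q : ℂ)) :
    ∃ c : ZMod n → ℚ, ∀ k, v k = ∑ j, stdAddChar (j * k) * (c j : ℂ) := by
  choose q hq using hEv
  refine ⟨fun j => (n : ℚ)⁻¹ * q (-j), fun k => ?_⟩
  have hdft (j : ZMod n) : ZMod.dft v j = q (-j) := by
    rw [← hq, ZMod.dft_apply]
    refine Finset.sum_congr rfl fun t _ => ?_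
    rw [smul_eq_mul, pow_mul, ← stdAddChar_eq_om_pow, ← AddChar.map_nsmul_eq_pow, nsmul_eq_mul,
      ZMod.natCast_zmod_val]
    congr 2
    ring
  have hinv := ZMod.invDFT_apply (ZMod.dft v) k
  rw [LinearEquiv.symm_apply_apply] at hinv
  rw [hinv, smul_eq_mul, Finset.mul_sum]
  refine Finset.sum_congr rfl fun j _ => ?_
  rw [hdft, smul_eq_mul]
  push_cast
  ring

open ZMod in
lemma apply_mul_eq_of_coprime {n : ℕ} [NeZero n] (h3 : 3 ∣ n) {v : ZMod n → ℂ} {c : ZMod n → ℚ}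
    (hc : ∀ k, v k = ∑ j, stdAddChar (j * k) * (c j : ℂ)) {k : ZMod n} {a b : ℚ}
    (hk : v k = (a : ℂ) + (b : ℂ) * om 3) {u : ℕ} (hu : u.Coprime n) :
    v (u * k) = (a : ℂ) + (b : ℂ) * om 3 ^ u := by
  let P : Polynomial ℚ := ∑ j : ZMod n, Polynomial.X ^ (j * k).val * Polynomial.C (c j)
    - (Polynomial.C a + Polynomial.C b * Polynomial.X ^ (n / 3))
  have hP (x : ℂ) : Polynomial.aeval x P =
      ∑ j : ZMod n, x ^ (j * k).val * (c j : ℂ) - ((a : ℂ) + (b : ℂ) * x ^ (n / 3)) := by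
    simp only [P, map_sub, map_sum, map_add, map_mul, map_pow, Polynomial.aeval_X,
      Polynomial.aeval_C, eq_ratCast]
  have h0 : Polynomial.aeval (om n) P = 0 := by
    rw [hP, om_pow_div h3, ← hk, hc, sub_eq_zero]
    exact Finset.sum_congr rfl fun j _ => by rw [stdAddChar_eq_om_pow]
  have h1 := aeval_om_pow_eq_zero hu h0
  rw [hP, pow_right_comm, om_pow_div h3, sub_eq_zero] at h1
  rw [← h1, hc]
  refine Finset.sum_congr rfl fun j _ => ?_
  rw [pow_right_comm, ← stdAddChar_eq_om_pow, ← AddChar.map_nsmul_eq_pow, nsmul_eq_mul]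
  congr 2
  ring

open ZMod in
lemma apply_mul_eq_self {n : ℕ} [NeZero n] (h3 : 3 ∣ n) {v : ZMod n → ℂ} {c : ZMod n → ℚ}
    (hc : ∀ k, v k = ∑ j, stdAddChar (j * k) * (c j : ℂ)) {k : ZMod n}
    (hk : ∃ a b : ℚ, v k = (a : ℂ) + (b : ℂ) * om 3) {u : ℕ} (hu : u.Coprime n)
    (hu3 : u ≡ 1 [MOD 3]) : v (u * k) = v k := by
  obtain ⟨a, b, hk⟩ := hk
  have h : om 3 ^ u = om 3 := by
    conv_rhs => rw [← pow_one (om 3)]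
    exact pow_eq_pow_of_modEq hu3 (isPrimitiveRoot_om 3).pow_eq_one
  rw [apply_mul_eq_of_coprime h3 hc hk hu, hk, h]

open ZMod in
lemma conj_apply_eq_apply_neg {n : ℕ} [NeZero n] {v : ZMod n → ℂ} {c : ZMod n → ℚ}
    (hc : ∀ k, v k = ∑ j, stdAddChar (j * k) * (c j : ℂ)) (k : ZMod n) :
    (starRingEnd ℂ) (v k) = v (-k) := by
  rw [hc, hc, map_sum]
  refine Finset.sum_congr rfl fun j _ => ?_
  rw [map_mul, ← AddChar.map_neg_eq_conj, mul_neg, map_ratCast]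

lemma exists_coprime_modEq {n m c : ℕ} [NeZero n] (hm : m ∣ n) (hc : c.Coprime m) :
    ∃ u : ℕ, u.Coprime n ∧ u ≡ c [MOD m] := by
  obtain ⟨y, hy⟩ := ZMod.unitsMap_surjective hm (ZMod.unitOfCoprime c hc)
  refine ⟨(y : ZMod n).val, ZMod.val_coe_unit_coprime y, ?_⟩
  rw [← ZMod.natCast_eq_natCast_iff]
  have h := congrArg Units.val hy
  rw [ZMod.unitsMap_val, ZMod.coe_unitOfCoprime, ZMod.cast_eq_val] at h
  exact h

theorem stmt12 (n : ℕ) [NeZero n] (h3 : n % 3 = 0) (v : ZMod n → ℂ)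
    (hv : ∀ s : ZMod n, ∃ a b : ℚ, v s = (a : ℂ) + (b : ℂ) * om 3)
    (hEv : ∀ s : ZMod n, ∃ q : ℚ, ∑ t : ZMod n, om n ^ (s.val * t.val) * v t = (q : ℂ)) :
    (∀ s : ZMod n, (starRingEnd ℂ) (v s) = v (-s)) ∧
    (∀ d : ℕ, d ∣ n / 3 → ∀ s t : ℕ, s ∈ G3 n d 1 → t ∈ G3 n d 1 →
      v (s : ZMod n) = v (t : ZMod n)) ∧
    (∀ d : ℕ, d ∣ n → ¬ d ∣ n / 3 → d < n → ∀ r ∈ Gn n d,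
      v (r : ZMod n) = v ((n - r : ℕ) : ZMod n)) := by
  have h3' : 3 ∣ n := Nat.dvd_of_mod_eq_zero h3
  obtain ⟨c, hc⟩ := exists_rat_stdAddChar_expansion hEv
  refine ⟨conj_apply_eq_apply_neg hc, ?_, ?_⟩
  · intro d hd s t hs ht
    simp only [G3, Finset.mem_filter, Finset.mem_Ico] at hs ht
    obtain ⟨⟨hs0, -⟩, hsd, hs3⟩ := hs
    obtain ⟨-, htd, ht3⟩ := ht
    have hd0 : 0 < d := hsd ▸ Nat.gcd_pos_of_pos_left _ hs0
    obtain ⟨e, he⟩ := hd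
    obtain ⟨k, rfl⟩ : d ∣ s := hsd ▸ Nat.gcd_dvd_left _ _
    obtain ⟨l, rfl⟩ : d ∣ t := htd ▸ Nat.gcd_dvd_left _ _
    have hn : n = d * (3 * e) := by
      rw [← Nat.mul_div_cancel' h3', he]
      ring
    rw [Nat.mul_div_cancel_left _ hd0] at hs3 ht3
    have coprime_of_gcd {x : ℕ} (hx : (d * x).gcd n = d) : x.Coprime (3 * e) := by
      rw [hn, Nat.gcd_mul_left] at hx
      exact Nat.eq_of_mul_eq_mul_left hd0 (hx.trans (mul_one d).symm)
    have hk := coprime_of_gcd hsd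
    have hl := coprime_of_gcd htd
    have he0 : 3 * e ≠ 0 := fun h => NeZero.ne n (by rw [hn, h, mul_zero])
    obtain ⟨k', -, hk'⟩ := Nat.exists_mul_mod_eq_of_coprime 1 hk he0
    replace hk' : k * k' ≡ 1 [MOD 3 * e] := hk'
    have hk'c : k'.Coprime (3 * e) := by
      have h := hk'.gcd_eq
      rw [Nat.gcd_one_left] at h
      exact Nat.Coprime.coprime_mul_left h
    obtain ⟨u, hu, hum⟩ := exists_coprime_modEq (n := n) (c := l * k') ⟨d, by rw [hn]; ring⟩
      (hl.mul_left hk'c)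
    have huk : u * k ≡ l [MOD 3 * e] := by
      calc u * k ≡ l * k' * k [MOD 3 * e] := hum.mul_right k
        _ = l * (k * k') := by ring
        _ ≡ l * 1 [MOD 3 * e] := hk'.mul_left l
        _ = l := mul_one l
    have hu3 : u ≡ 1 [MOD 3] := by
      calc u = u * 1 := (mul_one u).symm
        _ ≡ u * k [MOD 3] := Nat.ModEq.mul_left u hs3.symm
        _ ≡ l [MOD 3] := huk.of_mul_right e
        _ ≡ 1 [MOD 3] := ht3
    rw [← apply_mul_eq_self h3' hc (hv _) hu hu3, ← Nat.cast_mul]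
    congr 1
    rw [ZMod.natCast_eq_natCast_iff, mul_left_comm, hn]
    exact huk.mul_left' d
  · rintro d ⟨N, hN⟩ hd - r hr
    simp only [Gn, Finset.mem_filter, Finset.mem_Ico] at hr
    obtain ⟨⟨-, hrn⟩, hrd⟩ := hr
    obtain ⟨k, hk⟩ : d ∣ r := hrd ▸ Nat.gcd_dvd_left _ _
    have hN0 : 0 < N := Nat.pos_of_ne_zero fun h => NeZero.ne n (by rw [hN, h, mul_zero])
    have h3N : Nat.Coprime 3 N := by
      rw [Nat.prime_three.coprime_iff_not_dvd]
      rintro ⟨e, rfl⟩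
      exact hd ⟨e, by rw [hN, mul_left_comm, Nat.mul_div_cancel_left _ (by norm_num)]⟩
    obtain ⟨c₀, hc3, hcN⟩ := Nat.chineseRemainder h3N 1 (N - 1)
    have hcop : c₀.Coprime (3 * N) := by
      refine Nat.Coprime.mul_right ?_ ?_
      · exact hc3.gcd_eq.trans (Nat.gcd_one_left 3)
      · refine hcN.gcd_eq.trans ?_
        exact (Nat.coprime_self_sub_left hN0).2 (Nat.coprime_one_left N)
    obtain ⟨u, hu, hum⟩ := exists_coprime_modEq (n := n)
      (h3N.mul_dvd_of_dvd_of_dvd h3' ⟨d, by rw [hN]; ring⟩) hcop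
    have huN : u + 1 ≡ 0 [MOD N] := by
      calc u + 1 ≡ c₀ + 1 [MOD N] := (hum.of_mul_left 3).add_right 1
        _ ≡ N - 1 + 1 [MOD N] := hcN.add_right 1
        _ = N := Nat.sub_add_cancel hN0
        _ ≡ 0 [MOD N] := by simp [Nat.ModEq]
    have hur : u * r + r ≡ 0 [MOD n] := by
      calc u * r + r = d * ((u + 1) * k) := by rw [hk]; ring
        _ ≡ d * (0 * k) [MOD n] := by rw [hN]; exact (huN.mul_right k).mul_left' d
        _ = 0 := by simp
    rw [← apply_mul_eq_self h3' hc (hv _) hu ((hum.of_mul_right N).trans hc3)]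
    congr 1
    rw [Nat.cast_sub hrn.le, ZMod.natCast_self, zero_sub, eq_neg_iff_add_eq_zero]
    exact_mod_cast (ZMod.natCast_eq_natCast_iff _ _ _).2 hur
end
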